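/- Let P = ⟨H,M,T⟩ be an abduction problem and let h₁,…,h_k and m be fresh propositional variables not occurring in H, M, or T. Define P' = ⟨H ∪ {h₁,…,h_k}, M ∪ {m}, T ∪ { h₁ ∧ ⋯ ∧ h_k → m }⟩. Then the solutions of P' are exactly the solutions of P augmented with all the new hypotheses: SOL(P') = { S ∪ {h₁,…,h_k} : S ∈ SOL(P) }. -/

import Mathlib

/-- Propositional formulas over a set `V` of variables. -/
inductive PropForm (V : Type) : Type where
  | fls  : PropForm V
  | var  : V → PropForm V
  | neg  : PropForm V → PropForm V
  | conj : PropForm V → PropForm V → PropForm V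
  | disj : PropForm V → PropForm V → PropForm V
  | imp  : PropForm V → PropForm V → PropForm V
  deriving DecidableEq

namespace PropForm

/-- Truth of a formula under a valuation. -/
def eval {V : Type} (v : V → Prop) : PropForm V → Prop
  | fls => False
  | var x => v x
  | neg φ => ¬ eval v φ
  | conj φ ψ => eval v φ ∧ eval v ψ
  | disj φ ψ => eval v φ ∨ eval v ψ
  | imp φ ψ => eval v φ → eval v ψ

/-- The set of variables occurring in a formula. -/
def vars {V : Type} : PropForm V → Set V
  | fls => ∅
  | var x => {x}
  | neg φ => vars φ
  | conj φ ψ => vars φ ∪ vars ψ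
  | disj φ ψ => vars φ ∪ vars ψ
  | imp φ ψ => vars φ ∪ vars ψ

end PropForm

/-- An abduction problem `⟨H, M, T⟩`: hypotheses, manifestations, theory. -/
structure AbdProblem (V : Type) [DecidableEq V] : Type where
  H : Finset V
  M : Finset V
  T : Finset (PropForm V)

variable {V : Type} [DecidableEq V]

/-- `v` is a model of the hypotheses `A` together with the theory `T`. -/
def models (v : V → Prop) (A : Finset V) (T : Finset (PropForm V)) : Prop :=
  (∀ x ∈ A, v x) ∧ (∀ φ ∈ T, φ.eval v)

/-- `A` is a solution of `P`: `A ⊆ H`, `A ∪ T` is satisfiable, `A ∪ T ⊨ m` for `m ∈ M`. -/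
def isSol (P : AbdProblem V) (A : Finset V) : Prop :=
  A ⊆ P.H ∧ (∃ v, models v A P.T) ∧ ∀ v, models v A P.T → ∀ m ∈ P.M, v m

/-- The set of solutions of `P`. -/
def SOL (P : AbdProblem V) : Set (Finset V) := {A | isSol P A}

/-- The solutions of `P` minimal under set inclusion. -/
def SOLsub (P : AbdProblem V) : Set (Finset V) :=
  {A | A ∈ SOL P ∧ ∀ B ∈ SOL P, B ⊆ A → B = A}

/-- The solutions of `P` of minimum cardinality. -/
def SOLcard (P : AbdProblem V) : Set (Finset V) :=
  {A | A ∈ SOL P ∧ ∀ B ∈ SOL P, A.card ≤ B.card}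

/-- `x` is fresh for `P`: it occurs neither in `H`, nor in `M`, nor in any formula of `T`. -/
def freshFor (P : AbdProblem V) (x : V) : Prop :=
  x ∉ P.H ∧ x ∉ P.M ∧ ∀ φ ∈ P.T, x ∉ φ.vars

/-- The truth of a formula depends only on the values of the variables occurring in it. -/
theorem PropForm.eval_congr {W : Type} {v w : W → Prop} (φ : PropForm W)
    (hvw : ∀ x ∈ φ.vars, (v x ↔ w x)) : φ.eval v ↔ φ.eval w := by
  induction φ with
  | fls => exact Iff.rfl
  | var x => exact hvw x rfl
  | neg φ ih => exact not_congr (ih hvw)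
  | conj φ ψ ihφ ihψ =>
    exact and_congr (ihφ fun x hx => hvw x (Or.inl hx)) (ihψ fun x hx => hvw x (Or.inr hx))
  | disj φ ψ ihφ ihψ =>
    exact or_congr (ihφ fun x hx => hvw x (Or.inl hx)) (ihψ fun x hx => hvw x (Or.inr hx))
  | imp φ ψ ihφ ihψ =>
    exact imp_congr (ihφ fun x hx => hvw x (Or.inl hx)) (ihψ fun x hx => hvw x (Or.inr hx))

theorem PropForm.eval_foldr_conj {W : Type} (v : W → Prop) (l : List (PropForm W)) :
    (l.foldr PropForm.conj (PropForm.neg PropForm.fls)).eval v ↔ ∀ φ ∈ l, φ.eval v := by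
  induction l with
  | nil => simp [PropForm.eval]
  | cons φ l ih => simp [PropForm.eval, ih]

/-- Models of `T` extended by the rule `h₁ ∧ ⋯ ∧ hₖ → m`. -/
theorem models_union_rule {k : ℕ} (v : V → Prop) (A : Finset V) (T : Finset (PropForm V))
    (h : Fin k → V) (m : V) :
    models v A (T ∪ {PropForm.imp
        ((List.ofFn (fun i => PropForm.var (h i))).foldr PropForm.conj
          (PropForm.neg PropForm.fls))
        (PropForm.var m)}) ↔ models v A T ∧ ((∀ i, v (h i)) → v m) := by
  have hrule : (PropForm.imp
      ((List.ofFn (fun i => PropForm.var (h i))).foldr PropForm.conj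
        (PropForm.neg PropForm.fls)) (PropForm.var m)).eval v ↔ ((∀ i, v (h i)) → v m) := by
    rw [PropForm.eval, PropForm.eval_foldr_conj]
    simp [List.mem_ofFn, PropForm.eval]
  simp only [models, Finset.mem_union, Finset.mem_singleton, or_imp, forall_and, forall_eq,
    hrule, and_assoc]

theorem models_union_hypotheses {k : ℕ} (v : V → Prop) (S : Finset V) (T : Finset (PropForm V))
    (h : Fin k → V) :
    models v (S ∪ Finset.univ.image h) T ↔ models v S T ∧ ∀ i, v (h i) := by
  simp only [models, Finset.mem_union, or_imp, forall_and, Finset.mem_image, Finset.mem_univ,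
    true_and, forall_exists_index, forall_apply_eq_imp_iff]
  tauto

/-- Making all fresh variables true preserves the models of a set of hypotheses and the theory. -/
theorem models_fresh_or {P : AbdProblem V} {S : Finset V} {v : V → Prop}
    (hv : models v S P.T) : models (fun x => freshFor P x ∨ v x) S P.T :=
  ⟨fun x hx => Or.inr (hv.1 x hx), fun φ hφ =>
    (φ.eval_congr fun _ hx => ⟨Or.inr, fun hf => hf.resolve_left fun hf => hf.2.2 φ hφ hx⟩).1
      (hv.2 φ hφ)⟩

/-- Adjoining fresh hypotheses and a rule deriving a fresh manifestation from them preserves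
solutions. -/
theorem isSol_union_iff {P : AbdProblem V} {k : ℕ} {h : Fin k → V} {m : V}
    (hfresh : ∀ i, freshFor P (h i)) (hm : freshFor P m) {S : Finset V} (hS : S ⊆ P.H) :
    isSol ⟨P.H ∪ Finset.univ.image h, P.M ∪ {m},
        P.T ∪ {PropForm.imp
          ((List.ofFn (fun i => PropForm.var (h i))).foldr PropForm.conj
            (PropForm.neg PropForm.fls))
          (PropForm.var m)}⟩ (S ∪ Finset.univ.image h) ↔ isSol P S := by
  have key : ∀ {v}, models v S P.T →
      (models (fun x => freshFor P x ∨ v x) S P.T ∧ ∀ i, freshFor P (h i) ∨ v (h i)) ∧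
        ((∀ i, freshFor P (h i) ∨ v (h i)) → freshFor P m ∨ v m) := fun hv =>
    ⟨⟨models_fresh_or hv, fun i => Or.inl (hfresh i)⟩, fun _ => Or.inl hm⟩
  simp only [isSol, models_union_rule, models_union_hypotheses]
  constructor
  · rintro ⟨-, ⟨v, hv⟩, hent⟩
    refine ⟨hS, ⟨v, hv.1.1⟩, fun w hw x hx => ?_⟩
    exact (hent _ (key hw) x (Finset.mem_union_left _ hx)).resolve_left fun hf => hf.2.1 hx
  · rintro ⟨-, ⟨v, hv⟩, hent⟩
    refine ⟨Finset.union_subset_union_left hS, ⟨_, key hv⟩, fun w hw x hx => ?_⟩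
    rcases Finset.mem_union.1 hx with hx | hx
    · exact hent w hw.1.1 x hx
    · rw [Finset.mem_singleton.1 hx]
      exact hw.2 hw.1.2

/-- Every solution of the extended problem contains all the new hypotheses: otherwise a missing
one could be made false together with the new manifestation. -/
theorem image_subset_of_isSol {P : AbdProblem V} {k : ℕ} {h : Fin k → V} {m : V}
    (hfresh : ∀ i, freshFor P (h i)) (hm : freshFor P m) (hmh : ∀ i, m ≠ h i) {A : Finset V}
    (hA : isSol ⟨P.H ∪ Finset.univ.image h, P.M ∪ {m},
        P.T ∪ {PropForm.imp
          ((List.ofFn (fun i => PropForm.var (h i))).foldr PropForm.conj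
            (PropForm.neg PropForm.fls))
          (PropForm.var m)}⟩ A) : Finset.univ.image h ⊆ A := by
  simp only [isSol, models_union_rule] at hA
  obtain ⟨hsub, ⟨v, hv, -⟩, hent⟩ := hA
  intro x hx
  obtain ⟨i, -, rfl⟩ := Finset.mem_image.1 hx
  by_contra hi
  have hmA : m ∉ A := fun hmem => by
    rcases Finset.mem_union.1 (hsub hmem) with hH | hH
    · exact hm.1 hH
    · obtain ⟨j, -, hj⟩ := Finset.mem_image.1 hH
      exact hmh j hj.symm
  have hw : models (fun x => x ≠ h i ∧ x ≠ m ∧ v x) A P.T := by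
    refine ⟨fun x hx => ⟨ne_of_mem_of_not_mem hx hi, ne_of_mem_of_not_mem hx hmA, hv.1 x hx⟩,
      fun φ hφ => (φ.eval_congr fun x hx => ⟨fun hvx => ⟨?_, ?_, hvx⟩, fun hx => hx.2.2⟩).1
        (hv.2 φ hφ)⟩
    · rintro rfl
      exact (hfresh i).2.2 φ hφ hx
    · rintro rfl
      exact hm.2.2 φ hφ hx
  exact (hent _ ⟨hw, fun hall => absurd rfl (hall i).1⟩ m
    (Finset.mem_union_right _ (Finset.mem_singleton_self m))).2.1 rfl

theorem add_forced_hypotheses (P : AbdProblem V) (k : ℕ) (h : Fin k → V) (m : V)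
    (hinj : Function.Injective h)
    (hfresh : ∀ i, freshFor P (h i)) (hm : freshFor P m)
    (hmh : ∀ i, m ≠ h i) :
    SOL ⟨P.H ∪ Finset.univ.image h, P.M ∪ {m},
        P.T ∪ {PropForm.imp
          ((List.ofFn (fun i => PropForm.var (h i))).foldr PropForm.conj
            (PropForm.neg PropForm.fls))
          (PropForm.var m)}⟩
      = {A | ∃ S ∈ SOL P, A = S ∪ Finset.univ.image h} := by
  ext A
  constructor
  · intro hA
    have himg := image_subset_of_isSol hfresh hm hmh hA
    have hSH : A \ Finset.univ.image h ⊆ P.H :=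
      sdiff_le_iff.2 ((hA.1).trans_eq (Finset.union_comm _ _))
    have hunion := (Finset.sdiff_union_of_subset himg).symm
    refine ⟨_, (isSol_union_iff hfresh hm hSH).1 ?_, hunion⟩
    rwa [← hunion]
  · rintro ⟨S, hS, rfl⟩
    exact (isSol_union_iff hfresh hm hS.1).2 hS
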